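/- Assume F̄(x) > 0 for all x and log F̄(x) ∼ −φ(x) as x → ∞, where φ is continuous and strictly increasing to ∞ on some [x₀,∞), with inverse φ^{-1}. Suppose there are a function λ > 0 and a non-increasing continuous function ω on (0,1] with ω(1) = 0 such that (φ^{-1}(y) − φ^{-1}(v y))/λ(y) → ω(v) as y → ∞ for every v ∈ (0,1]. Define ρ(β) = inf_{0 < h < 1−β} [ω(h) − ω(2β − 1 + 2h)]. Let 1/2 < β < 1, ε_n ∈ (0,1/2] with n^β ε_n → 1, and μ_n with μ_n/(r λ(log n)) → 1 for a fixed r > ρ(β). Then for every level α ∈ (0,1), the power of the oracle threshold test tends to 1: sup_{t∈ℝ} P(Binomial(n, q_t(μ_n)) ≥ c_t) → 1. -/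

import Mathlib

open Filter

/-- Upper tail of the binomial distribution: `P(Binomial(n,p) ≥ c)`. -/
noncomputable def binomTail (n : ℕ) (p : ℝ) (c : ℕ) : ℝ :=
  ∑ k ∈ Finset.Icc c n, (n.choose k : ℝ) * p ^ k * (1 - p) ^ (n - k)

/-- Level-`α` critical value: the smallest `c : ℕ` with `P(Binomial(n,p) ≥ c) ≤ α`. -/
noncomputable def critVal (n : ℕ) (p α : ℝ) : ℕ :=
  sInf {c : ℕ | binomTail n p c ≤ α}

lemma bin_nonneg (n k : ℕ) (p : ℝ) (h0 : 0 ≤ p) (h1 : p ≤ 1) :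
    0 ≤ (n.choose k : ℝ) * p ^ k * (1 - p) ^ (n - k) := by
  have : 0 ≤ 1 - p := by linarith
  positivity

lemma bin_sum (n : ℕ) (p : ℝ) :
    ∑ k ∈ Finset.range (n + 1), (n.choose k : ℝ) * p ^ k * (1 - p) ^ (n - k) = 1 := by
  have h := congrArg (Polynomial.eval p) (bernsteinPolynomial.sum ℝ n)
  simpa [Polynomial.eval_finsetSum, bernsteinPolynomial] using h

lemma bin_var (n : ℕ) (p : ℝ) :
    ∑ k ∈ Finset.range (n + 1),
      (n * p - k) ^ 2 * ((n.choose k : ℝ) * p ^ k * (1 - p) ^ (n - k)) = n * p * (1 - p) := by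
  have h := congrArg (Polynomial.eval p) (bernsteinPolynomial.variance ℝ n)
  simpa [Polynomial.eval_finsetSum, bernsteinPolynomial, mul_assoc] using h

lemma bin_cheb (n : ℕ) (p x : ℝ) (h0 : 0 ≤ p) (h1 : p ≤ 1) (hx : 0 < x) (S : Finset ℕ)
    (hS : S ⊆ Finset.range (n + 1)) (hd : ∀ k ∈ S, x ^ 2 ≤ (n * p - k) ^ 2) :
    ∑ k ∈ S, (n.choose k : ℝ) * p ^ k * (1 - p) ^ (n - k) ≤ n * p / x ^ 2 := by
  rw [le_div_iff₀ (by positivity), Finset.sum_mul]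
  calc _ ≤ ∑ k ∈ S, (n * p - k) ^ 2 * ((n.choose k : ℝ) * p ^ k * (1 - p) ^ (n - k)) := by
        apply Finset.sum_le_sum
        intro k hk
        rw [mul_comm]
        exact mul_le_mul_of_nonneg_right (hd k hk) (bin_nonneg n k p h0 h1)
    _ ≤ ∑ k ∈ Finset.range (n + 1),
          (n * p - k) ^ 2 * ((n.choose k : ℝ) * p ^ k * (1 - p) ^ (n - k)) := by
        apply Finset.sum_le_sum_of_subset_of_nonneg hS
        intro k _ _
        exact mul_nonneg (sq_nonneg _) (bin_nonneg n k p h0 h1)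
    _ = n * p * (1 - p) := bin_var n p
    _ ≤ n * p := by
        have : 0 ≤ n * p := by positivity
        nlinarith

lemma tail_le_one (n c : ℕ) (p : ℝ) (h0 : 0 ≤ p) (h1 : p ≤ 1) : binomTail n p c ≤ 1 := by
  rw [← bin_sum n p, binomTail]
  apply Finset.sum_le_sum_of_subset_of_nonneg
  · intro k hk
    simp at hk ⊢
    omega
  · intro k _ _
    exact bin_nonneg n k p h0 h1

lemma tail_compl (n c : ℕ) (p : ℝ) (h0 : 0 ≤ p) (h1 : p ≤ 1) :
    1 - ∑ k ∈ (Finset.range (n + 1)).filter (fun k => k < c),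
      (n.choose k : ℝ) * p ^ k * (1 - p) ^ (n - k) ≤ binomTail n p c := by
  have hb := bin_sum n p
  rw [← Finset.sum_filter_add_sum_filter_not (Finset.range (n + 1)) (fun k => k < c)] at hb
  rw [← eq_sub_iff_add_eq'] at hb
  rw [← hb, binomTail]
  apply Finset.sum_le_sum_of_subset_of_nonneg
  · intro k hk
    simp at hk ⊢
    omega
  · intro k _ _
    exact bin_nonneg n k p h0 h1

lemma power_bound (n : ℕ) (p q α : ℝ) (hn : 0 < n) (hp : 0 < p) (hp1 : p ≤ 1) (hq0 : 0 ≤ q)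
    (hq1 : q ≤ 1) (hα : 0 < α) (d : ℝ) (hd : d = n * (q - p)) (hd0 : 0 < d)
    (hx : Real.sqrt (n * p / α) + 1 ≤ d / 2) :
    1 - (4 * (n * p / d ^ 2) + 4 / d) ≤ binomTail n q (critVal n p α) := by
  have hn' : (0 : ℝ) < n := by exact_mod_cast hn
  set x := Real.sqrt (n * p / α) with hxd
  have hx0 : 0 < x := Real.sqrt_pos.mpr (by positivity)
  have hx2 : x ^ 2 = n * p / α := Real.sq_sqrt (by positivity)
  have hcrit : critVal n p α ≤ ⌈n * p + x⌉₊ := by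
    apply Nat.sInf_le
    show binomTail n p _ ≤ α
    refine (bin_cheb n p x hp.le hp1 hx0 _ ?_ ?_).trans ?_
    · intro k hk
      simp at hk ⊢
      omega
    · intro k hk
      have h1 : n * p + x ≤ k := Nat.ceil_le.mp (Finset.mem_Icc.mp hk).1
      nlinarith
    · rw [hx2]
      apply le_of_eq
      field_simp
  have hc : (critVal n p α : ℝ) ≤ n * p + x + 1 := by
    have h1 : (critVal n p α : ℝ) ≤ (⌈n * p + x⌉₊ : ℝ) := by exact_mod_cast hcrit
    have h2 := Nat.ceil_lt_add_one (show 0 ≤ n * p + x by positivity)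
    linarith
  refine le_trans ?_ (tail_compl n _ q hq0 hq1)
  have h := bin_cheb n q (d / 2) hq0 hq1 (by positivity)
    ((Finset.range (n + 1)).filter (fun k => k < critVal n p α)) (Finset.filter_subset _ _) (by
      intro k hk
      have h1 : (k : ℝ) ≤ critVal n p α := by exact_mod_cast (Finset.mem_filter.mp hk).2.le
      have h2 : d / 2 ≤ n * q - k := by linarith
      exact pow_le_pow_left₀ (by positivity) h2 2)
  have h3 : n * q / (d / 2) ^ 2 = 4 * (n * p / d ^ 2) + 4 / d := by
    have : n * q = n * p + d := by linarith
    rw [this]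
    field_simp
    ring
  linarith

lemma power_tendsto (p q d : ℕ → ℝ) (α : ℝ) (hα : 0 < α)
    (hp : ∀ᶠ n in atTop, 0 < p n ∧ p n ≤ 1) (hq : ∀ᶠ n in atTop, 0 ≤ q n ∧ q n ≤ 1)
    (hd : ∀ n, d n = n * (q n - p n)) (hdt : Tendsto d atTop atTop)
    (hr : Tendsto (fun n : ℕ => n * p n / d n ^ 2) atTop (nhds 0)) :
    ∃ u : ℕ → ℝ, Tendsto u atTop (nhds 1) ∧
      ∀ᶠ n in atTop, u n ≤ binomTail n (q n) (critVal n (p n) α) := by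
  refine ⟨fun n => 1 - (4 * (n * p n / d n ^ 2) + 4 / d n), ?_, ?_⟩
  · have h1 : Tendsto (fun n => 4 / d n) atTop (nhds 0) := hdt.const_div_atTop 4
    simpa using ((hr.const_mul 4).add h1).const_sub 1
  · filter_upwards [hp, hq, eventually_gt_atTop 0, hdt.eventually_ge_atTop 4,
      hr.eventually_le_const (show 0 < α / 16 by positivity)] with n hp hq hn hd4 hrn
    refine power_bound n (p n) (q n) α hn hp.1 hp.2 hq.1 hq.2 hα _ (hd n) (by linarith) ?_
    have hd0 : 0 < d n := by linarith
    have : Real.sqrt (n * p n / α) ≤ d n / 4 := by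
      apply Real.sqrt_le_iff.mpr
      refine ⟨by positivity, ?_⟩
      rw [div_le_iff₀ (by positivity)] at hrn ⊢
      nlinarith
    linarith

lemma phi_inv_top (φ φinv : ℝ → ℝ) (x₀ : ℝ)
    (hφcont : ContinuousOn φ (Set.Ici x₀)) (hφmono : StrictMonoOn φ (Set.Ici x₀))
    (hφtop : Tendsto φ atTop atTop)
    (hφinv₁ : ∀ x ∈ Set.Ici x₀, φinv (φ x) = x) : Tendsto φinv atTop atTop := by
  rw [tendsto_atTop]
  intro M
  have key : ∀ y, φ x₀ ≤ y → ∃ x ∈ Set.Ici x₀, φ x = y := by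
    intro y hy
    obtain ⟨X, hX, hX0⟩ := ((hφtop.eventually_ge_atTop y).and (eventually_ge_atTop x₀)).exists
    obtain ⟨x, hx, hxy⟩ := intermediate_value_Icc hX0 (hφcont.mono Set.Icc_subset_Ici_self) ⟨hy, hX⟩
    exact ⟨x, hx.1, hxy⟩
  filter_upwards [eventually_ge_atTop (φ x₀), eventually_ge_atTop (φ (max M x₀))] with y h1 h2
  obtain ⟨x, hx, rfl⟩ := key y h1
  rw [hφinv₁ x hx]
  exact (le_max_left M x₀).trans ((hφmono.le_iff_le (Set.mem_Ici.mpr (le_max_right M x₀)) hx).mp h2)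

/-- In the models where `(φ⁻¹(y) - φ⁻¹(vy))/λ(y) → ω(v)`, above the detection boundary
`r = ρ(β) = inf_{0<h<1-β} [ω(h) - ω(2β-1+2h)]` the oracle threshold test is
asymptotically powerful. -/
theorem oracle_threshold_achieves_boundary_other_models
    (F : ℝ → ℝ) (hFcont : Continuous F) (hFmono : Monotone F)
    (hFbot : Tendsto F atBot (nhds 0)) (hFtop : Tendsto F atTop (nhds 1))
    (hFbar : ∀ x, 0 < 1 - F x)
    (φ φinv lam ω : ℝ → ℝ) (x₀ : ℝ)
    (hφcont : ContinuousOn φ (Set.Ici x₀)) (hφmono : StrictMonoOn φ (Set.Ici x₀))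
    (hφtop : Tendsto φ atTop atTop)
    (hφinv₁ : ∀ x ∈ Set.Ici x₀, φinv (φ x) = x)
    (hφinv₂ : ∀ y ∈ Set.Ici (φ x₀), φ (φinv y) = y)
    (hlam : ∀ y, 0 < lam y)
    (hωanti : AntitoneOn ω (Set.Ioc (0 : ℝ) 1))
    (hωcont : ContinuousOn ω (Set.Ioc (0 : ℝ) 1))
    (hω1 : ω 1 = 0)
    (hreg : ∀ v ∈ Set.Ioc (0 : ℝ) 1,
      Tendsto (fun y => (φinv y - φinv (v * y)) / lam y) atTop (nhds (ω v)))
    (hlogF : Tendsto (fun x => Real.log (1 - F x) / (-φ x)) atTop (nhds 1))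
    (β r : ℝ) (hβ : β ∈ Set.Ioo (1 / 2 : ℝ) 1)
    (hr : sInf ((fun h => ω h - ω (2 * β - 1 + 2 * h)) '' Set.Ioo 0 (1 - β)) < r)
    (ε : ℕ → ℝ) (hε : ∀ n, ε n ∈ Set.Ioc (0 : ℝ) (1 / 2))
    (hεβ : Tendsto (fun n : ℕ => (n : ℝ) ^ β * ε n) atTop (nhds 1))
    (μ : ℕ → ℝ) (hμ : ∀ n, 0 ≤ μ n)
    (hμr : Tendsto (fun n : ℕ => μ n / (r * lam (Real.log n))) atTop (nhds 1))
    (α : ℝ) (hα : α ∈ Set.Ioo (0 : ℝ) 1) :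
    Tendsto (fun n : ℕ =>
        ⨆ t : ℝ, binomTail n ((1 - ε n) * (1 - F t) + ε n * (1 - F (t - μ n)))
          (critVal n (1 - F t) α))
      atTop (nhds 1) := by
  obtain ⟨hβ1, hβ2⟩ := hβ
  have hinvtop := phi_inv_top φ φinv x₀ hφcont hφmono hφtop hφinv₁
  have hF0 : ∀ x, 0 ≤ F x := fun x => hFmono.le_of_tendsto hFbot x
  -- choose h
  obtain ⟨_, ⟨h, ⟨hh0, hh1⟩, rfl⟩, hhr⟩ := exists_lt_of_csInf_lt
    (Set.Nonempty.image _ (Set.nonempty_Ioo.mpr (by linarith))) hr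
  simp only at hhr
  set s := 2 * β - 1 + 2 * h with hs
  have hs0 : 0 < s := by linarith
  have hs1 : s < 1 := by linarith
  have hr0 : 0 < r := by
    have := hωanti ⟨hh0, by linarith⟩ ⟨hs0, hs1.le⟩ (show h ≤ s by linarith)
    linarith
  -- choose s'
  obtain ⟨s', hs's, hs'1, hs'r⟩ : ∃ s', s < s' ∧ s' < 1 ∧ ω h - ω s' < r := by
    have hc : ContinuousAt ω s := hωcont.continuousAt (Ioc_mem_nhds hs0 hs1)
    have h1 : ∀ᶠ z in nhds s, ω h - ω z < r :=
      (hc.const_sub (ω h)).eventually_lt_const hhr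
    have h2 : ∀ᶠ z in nhdsWithin s (Set.Ioi s), s < z ∧ z < 1 ∧ ω h - ω z < r := by
      filter_upwards [self_mem_nhdsWithin, nhdsWithin_le_nhds h1,
        nhdsWithin_le_nhds (Iio_mem_nhds hs1)] with z a b c
      exact ⟨a, c, b⟩
    exact h2.exists
  obtain ⟨δ, hδ⟩ : ∃ δ, δ = (s' - s) / 8 := ⟨_, rfl⟩
  have hδ0 : 0 < δ := by rw [hδ]; linarith
  have hL : Tendsto (fun n : ℕ => Real.log n) atTop atTop :=
    Real.tendsto_log_atTop.comp tendsto_natCast_atTop_atTop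
  -- log Fbar along φinv
  have hlog : ∀ v : ℝ, 0 < v →
      Tendsto (fun n : ℕ => Real.log (1 - F (φinv (v * Real.log n))) / Real.log n)
        atTop (nhds (-v)) := by
    intro v hv
    have hy : Tendsto (fun n : ℕ => v * Real.log n) atTop atTop := hL.const_mul_atTop hv
    have h1 := (hlogF.comp (hinvtop.comp hy)).mul_const (-v)
    rw [one_mul] at h1
    refine h1.congr' ?_
    filter_upwards [hy.eventually_ge_atTop (φ x₀), hL.eventually_gt_atTop 0] with n h2 h3
    simp only [Function.comp]
    rw [hφinv₂ _ h2]
    field_simp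
  let t : ℕ → ℝ := fun n => φinv (s' * Real.log n)
  have ev1 : ∀ᶠ n : ℕ in atTop, 1 - F (t n) ≤ Real.exp (-(s' - δ) * Real.log n) := by
    filter_upwards [(hlog s' (by linarith)).eventually_le_const
      (show -s' < -(s' - δ) by linarith), hL.eventually_gt_atTop 0] with n h1 h2
    rw [div_le_iff₀ h2] at h1
    exact (Real.log_le_iff_le_exp (hFbar _)).mp h1
  have ev2 : ∀ᶠ n : ℕ in atTop, t n - μ n ≤ φinv (h * Real.log n) := by
    have h1 := ((hreg h ⟨hh0, by linarith⟩).comp hL).sub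
      ((hreg s' ⟨by linarith, hs'1.le⟩).comp hL)
    have h2 : Tendsto (fun n : ℕ => μ n / lam (Real.log n)) atTop (nhds r) := by
      have := hμr.mul_const r
      rw [one_mul] at this
      refine this.congr ?_
      intro n
      have := hlam (Real.log n)
      field_simp
    filter_upwards [h1.eventually_lt h2 hs'r] with n h3
    have := hlam (Real.log n)
    simp only [Function.comp] at h3
    rw [← sub_div, div_lt_div_iff_of_pos_right this] at h3
    simp only [t]
    linarith
  have ev3 : ∀ᶠ n : ℕ in atTop, Real.exp (-(h + δ) * Real.log n) ≤ 1 - F (t n - μ n) := by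
    filter_upwards [(hlog h hh0).eventually_const_le
      (show -(h + δ) < -h by linarith), hL.eventually_gt_atTop 0, ev2] with n h1 h2 h3
    rw [le_div_iff₀ h2] at h1
    have := (Real.le_log_iff_exp_le (hFbar _)).mp h1
    have := hFmono h3
    linarith
  have ev4 : ∀ᶠ n : ℕ in atTop, Real.exp (-β * Real.log n) / 2 ≤ ε n := by
    filter_upwards [hεβ.eventually_const_le (show (1 / 2 : ℝ) < 1 by norm_num),
      eventually_gt_atTop 0] with n h1 h2
    have hn : (0 : ℝ) < n := by exact_mod_cast h2
    rw [Real.rpow_def_of_pos hn] at h1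
    rw [neg_mul, Real.exp_neg, mul_comm β]
    have := Real.exp_pos (Real.log n * β)
    rw [div_le_iff₀ (by norm_num), inv_le_iff_one_le_mul₀ this]
    linarith
  have hexp0 : ∀ c : ℝ, 0 < c → Tendsto (fun n : ℕ => Real.exp (-c * Real.log n)) atTop (nhds 0) := by
    intro c hc
    exact Real.tendsto_exp_atBot.comp (hL.const_mul_atTop_of_neg (by linarith))
  have ev5 : ∀ᶠ n : ℕ in atTop,
      Real.exp (-(s' - δ) * Real.log n) ≤ Real.exp (-(h + δ) * Real.log n) / 2 := by
    filter_upwards [(hexp0 (s' - δ - (h + δ)) (by linarith)).eventually_le_const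
      (show (0 : ℝ) < 1 / 2 by norm_num)] with n h1
    have : Real.exp (-(s' - δ) * Real.log n) = Real.exp (-(h + δ) * Real.log n) *
        Real.exp (-(s' - δ - (h + δ)) * Real.log n) := by
      rw [← Real.exp_add]
      congr 1
      ring
    rw [this]
    have := Real.exp_pos (-(h + δ) * Real.log n)
    nlinarith
  let q : ℕ → ℝ → ℝ := fun n t => (1 - ε n) * (1 - F t) + ε n * (1 - F (t - μ n))
  have hq : ∀ n t, 0 ≤ q n t ∧ q n t ≤ 1 := by
    intro n t
    have h1 := hε n
    have h2 : ε n ≤ 1 / 2 := h1.2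
    have h3 : 0 < ε n := h1.1
    have h4 : 0 ≤ 1 - ε n := by linarith
    have := hFbar t
    have := hFbar (t - μ n)
    have := hF0 t
    have := hF0 (t - μ n)
    refine ⟨by positivity, ?_⟩
    simp only [q]
    nlinarith
  let d : ℕ → ℝ := fun n => n * (q n (t n) - (1 - F (t n)))
  have hdlow : ∀ᶠ n : ℕ in atTop, Real.exp ((1 - β - h - δ) * Real.log n) / 4 ≤ d n := by
    filter_upwards [ev1, ev3, ev4, ev5, eventually_gt_atTop 0] with n h1 h3 h4 h5 hn0
    have hn : (0 : ℝ) < n := by exact_mod_cast hn0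
    have e : Real.exp ((1 - β - h - δ) * Real.log n) / 4 =
        n * ((Real.exp (-β * Real.log n) / 2) * (Real.exp (-(h + δ) * Real.log n) / 2)) := by
      conv_rhs => rw [← Real.exp_log hn, Real.log_exp]
      rw [show (1 - β - h - δ) * Real.log n =
        Real.log n + (-β * Real.log n) + (-(h + δ) * Real.log n) by ring, Real.exp_add, Real.exp_add]
      ring
    have e2 : d n = n * (ε n * ((1 - F (t n - μ n)) - (1 - F (t n)))) := by
      simp only [d, q]
      ring
    rw [e, e2]
    apply mul_le_mul_of_nonneg_left _ hn.le
    apply mul_le_mul h4 (by linarith) (by positivity) (hε n).1.le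
  have hdt : Tendsto d atTop atTop := by
    refine tendsto_atTop_mono' _ hdlow ?_
    exact (Real.tendsto_exp_atTop.comp (hL.const_mul_atTop (by linarith))).atTop_div_const (by norm_num)
  have hratio : Tendsto (fun n : ℕ => n * (1 - F (t n)) / d n ^ 2) atTop (nhds 0) := by
    have hz := (hexp0 (2 * (1 - β - h - δ) - (1 - (s' - δ))) (by linarith)).const_mul 16
    rw [mul_zero] at hz
    refine squeeze_zero' ?_ ?_ hz
    · refine Eventually.of_forall fun n => ?_
      have := hFbar (t n)
      positivity
    · filter_upwards [ev1, hdlow, eventually_gt_atTop 0] with n h1 h2 hn0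
      have hn : (0 : ℝ) < n := by exact_mod_cast hn0
      have hE := Real.exp_pos ((1 - β - h - δ) * Real.log n)
      have hd0 : 0 < d n := by linarith
      rw [div_le_iff₀ (by positivity)]
      have h3 : (Real.exp ((1 - β - h - δ) * Real.log n) / 4) ^ 2 ≤ d n ^ 2 :=
        pow_le_pow_left₀ (by positivity) h2 2
      calc n * (1 - F (t n)) ≤ n * Real.exp (-(s' - δ) * Real.log n) :=
            mul_le_mul_of_nonneg_left h1 hn.le
        _ = 16 * Real.exp (-(2 * (1 - β - h - δ) - (1 - (s' - δ))) * Real.log n) *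
            (Real.exp ((1 - β - h - δ) * Real.log n) / 4) ^ 2 := by
          conv_lhs => rw [← Real.exp_log hn, Real.log_exp]
          rw [div_pow, ← Real.exp_nat_mul, ← Real.exp_add,
            show ∀ a b : ℝ, 16 * a * (b / 4 ^ 2) = a * b by intro a b; ring, ← Real.exp_add]
          congr 1
          push_cast
          ring
        _ ≤ _ := by
          apply mul_le_mul_of_nonneg_left h3
          positivity
  obtain ⟨u, hu1, hu2⟩ := power_tendsto (fun n => 1 - F (t n)) (fun n => q n (t n)) d α hα.1
    (Eventually.of_forall fun n => ⟨hFbar _, by linarith [hF0 (t n)]⟩)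
    (Eventually.of_forall fun n => hq n _) (fun n => rfl) hdt hratio
  refine tendsto_of_tendsto_of_tendsto_of_le_of_le' hu1 tendsto_const_nhds ?_ ?_
  · filter_upwards [hu2] with n hn
    refine hn.trans ?_
    refine le_ciSup (f := fun t : ℝ => binomTail n (q n t) (critVal n (1 - F t) α)) ?_ (t n)
    refine ⟨1, ?_⟩
    rintro _ ⟨z, rfl⟩
    exact tail_le_one _ _ _ (hq n z).1 (hq n z).2
  · refine Eventually.of_forall fun n => ?_
    exact ciSup_le fun z => tail_le_one _ _ _ (hq n z).1 (hq n z).2
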